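/- 𝔥(T(ℝⁿ)) is dense in 𝔥(T(O)): let O ⊆ ℝⁿ be open and convex and let φ ∈ 𝔥(T(O)). Then for every compact convex set K ⊂ O, every N ∈ ℕ and every ε > 0, there exists an entire function χ on ℂⁿ satisfying sup_{|Im z|≤m}(1+|z|)^j |χ(z)| < ∞ for all m > 0 and j ∈ ℕ, such that sup_{z ∈ ℝⁿ+iK} (1+|z|)^N |φ(z) − χ(z)| < ε. -/

import Mathlib

open MeasureTheory Complex Filter Topology

noncomputable section

/-- Partial derivative in the `i`-th coordinate direction. -/
def pd {n : ℕ} (i : Fin n) (f : (Fin n → ℝ) → ℂ) : (Fin n → ℝ) → ℂ :=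
  fun x => fderiv ℝ f x (Pi.single i 1)

/-- Multi-index derivative `D^α`. -/
def Dm {n : ℕ} (α : Fin n → ℕ) (f : (Fin n → ℝ) → ℂ) : (Fin n → ℝ) → ℂ :=
  (List.finRange n).foldr (fun i g => (pd i)^[α i] g) f

/-- Order `|α|` of a multi-index. -/
def mOrd {n : ℕ} (α : Fin n → ℕ) : ℕ := ∑ i, α i

/-- Supporting function `h_K(ξ) = sup_{x ∈ K} ⟨ξ,x⟩` of a set `K`. -/
def hSupp {n : ℕ} (K : Set (Fin n → ℝ)) (ξ : Fin n → ℝ) : ℝ :=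
  sSup ((fun x => ∑ i, ξ i * x i) '' K)

/-- The ℓ¹ norm `|ξ|₁ = ∑ i |ξ i|`. -/
def n1 {n : ℕ} (ξ : Fin n → ℝ) : ℝ := ∑ i, |ξ i|

/-- The vector of imaginary parts of `z ∈ ℂⁿ`. -/
def imv {n : ℕ} (z : Fin n → ℂ) : Fin n → ℝ := fun i => (z i).im

/-- Euclidean norm `|z|` on `ℂⁿ`. -/
def cnorm {n : ℕ} (z : Fin n → ℂ) : ℝ := Real.sqrt (∑ i, ‖z i‖ ^ 2)

/-- Membership in `𝔥(T(O))`: for every compact convex `K ⊂ O`, continuous on the tube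
`T(K) = ℝⁿ + iK`, holomorphic in its interior, and rapidly decreasing there. -/
def memFrak {n : ℕ} (O : Set (Fin n → ℝ)) (φ : (Fin n → ℂ) → ℂ) : Prop :=
  ∀ K : Set (Fin n → ℝ), K ⊆ O → IsCompact K → Convex ℝ K →
    ContinuousOn φ {z | imv z ∈ K} ∧
    DifferentiableOn ℂ φ (interior {z | imv z ∈ K}) ∧
    ∀ N : ℕ, ∃ M : ℝ, ∀ z : Fin n → ℂ, imv z ∈ K → (1 + cnorm z) ^ N * ‖φ z‖ ≤ M

/-- Membership in `𝔥(T(ℝⁿ))`: entire and rapidly decreasing in every horizontal strip. -/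
def memFrakRn {n : ℕ} (χ : (Fin n → ℂ) → ℂ) : Prop :=
  Differentiable ℂ χ ∧ ∀ m : ℝ, 0 < m → ∀ j : ℕ, ∃ M : ℝ,
    ∀ z : Fin n → ℂ, (∀ i, |(z i).im| ≤ m) → (1 + cnorm z) ^ j * ‖χ z‖ ≤ M

lemma cnorm_nonneg {n : ℕ} (z : Fin n → ℂ) : 0 ≤ cnorm z := Real.sqrt_nonneg _

lemma cnorm_eq_norm_toLp {n : ℕ} (z : Fin n → ℂ) : cnorm z = ‖WithLp.toLp 2 z‖ := by
  rw [EuclideanSpace.norm_eq, cnorm]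

lemma cnorm_add_le {n : ℕ} (z w : Fin n → ℂ) : cnorm (z + w) ≤ cnorm z + cnorm w := by
  simpa only [cnorm_eq_norm_toLp, WithLp.toLp_add] using norm_add_le _ _

lemma cnorm_neg {n : ℕ} (z : Fin n → ℂ) : cnorm (-z) = cnorm z := by
  simp [cnorm]

lemma cnorm_real_smul {n : ℕ} (a : ℝ) (z : Fin n → ℂ) : cnorm (a • z) = |a| * cnorm z := by
  simp only [cnorm_eq_norm_toLp, WithLp.toLp_smul, norm_smul, Real.norm_eq_abs]

lemma continuous_cnorm {n : ℕ} : Continuous (cnorm : (Fin n → ℂ) → ℝ) := by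
  unfold cnorm; fun_prop

lemma norm_le_cnorm {n : ℕ} (z : Fin n → ℂ) : ‖z‖ ≤ cnorm z := by
  refine (pi_norm_le_iff_of_nonneg (cnorm_nonneg z)).2 fun i => Real.le_sqrt_of_sq_le ?_
  exact Finset.single_le_sum (f := fun i => ‖z i‖ ^ 2) (fun _ _ => by positivity)
    (Finset.mem_univ i)

lemma cnorm_le_mul_norm {n : ℕ} (z : Fin n → ℂ) : cnorm z ≤ n * ‖z‖ := by
  refine Real.sqrt_le_iff.2 ⟨by positivity, ?_⟩
  calc ∑ i, ‖z i‖ ^ 2 ≤ ∑ _i : Fin n, ‖z‖ ^ 2 := by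
        gcongr with i; exact norm_le_pi_norm z i
    _ = n * ‖z‖ ^ 2 := by simp
    _ ≤ (n * n) * ‖z‖ ^ 2 := by
        gcongr; exact_mod_cast Nat.le_mul_self n
    _ = (n * ‖z‖) ^ 2 := by ring

lemma one_add_cnorm_add_le {n : ℕ} (z w : Fin n → ℂ) :
    1 + cnorm (z + w) ≤ (1 + cnorm z) * (1 + cnorm w) := by
  nlinarith [cnorm_add_le z w, mul_nonneg (cnorm_nonneg z) (cnorm_nonneg w)]

/-- The inclusion `ℝⁿ ⊆ ℂⁿ`. -/
def ofRealVec {n : ℕ} (t : Fin n → ℝ) : Fin n → ℂ := fun i => (t i : ℂ)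

lemma continuous_ofRealVec {n : ℕ} : Continuous (ofRealVec : (Fin n → ℝ) → _) := by
  unfold ofRealVec; fun_prop

lemma norm_ofRealVec {n : ℕ} (t : Fin n → ℝ) : ‖ofRealVec t‖ = ‖t‖ := by
  simp [ofRealVec, Pi.norm_def]

lemma continuous_imv {n : ℕ} : Continuous (imv : (Fin n → ℂ) → _) := by
  unfold imv; fun_prop

lemma dist_imv_le {n : ℕ} (z w : Fin n → ℂ) : dist (imv z) (imv w) ≤ dist z w := by
  refine (dist_pi_le_iff dist_nonneg).2 fun i => le_trans ?_ (dist_le_pi_dist z w i)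
  simpa [imv, Real.dist_eq, Complex.dist_eq] using Complex.abs_im_le_norm (z i - w i)

lemma imv_ofRealVec_add {n : ℕ} (t : Fin n → ℝ) (z : Fin n → ℂ) :
    imv (ofRealVec t + z) = imv z := by
  ext i; simp [imv, ofRealVec]

lemma inv_one_add_cnorm_pow_le {n : ℕ} (N : ℕ) (t : Fin n → ℝ) (z : Fin n → ℂ) :
    ((1 + cnorm (ofRealVec t + z)) ^ N)⁻¹ ≤ (1 + cnorm z) ^ N * ((1 + ‖t‖) ^ N)⁻¹ := by
  have h0 := cnorm_nonneg (ofRealVec t + z)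
  rw [← div_eq_mul_inv, inv_eq_one_div, div_le_div_iff₀ (by positivity) (by positivity), one_mul,
    ← mul_pow]
  refine pow_le_pow_left₀ (by positivity) ?_ N
  calc 1 + ‖t‖ ≤ 1 + cnorm (ofRealVec t) := by
        rw [← norm_ofRealVec]; gcongr; exact norm_le_cnorm _
    _ = 1 + cnorm (-z + (ofRealVec t + z)) := by congr 2; abel
    _ ≤ _ := by simpa [cnorm_neg] using one_add_cnorm_add_le (-z) (ofRealVec t + z)

lemma integrable_inv_one_add_norm_pow (n : ℕ) :
    Integrable (fun t : Fin n → ℝ => ((1 + ‖t‖) ^ (n + 1))⁻¹) := by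
  refine (integrable_one_add_norm (E := Fin n → ℝ) (μ := volume) (r := ((n + 1 : ℕ) : ℝ))
    (by simp)).congr (.of_forall fun t => ?_)
  simp only
  rw [Real.rpow_neg (by positivity), Real.rpow_natCast]

/-- A holomorphic family dominated locally uniformly by `(1 + ‖t‖)⁻ⁿ⁻¹` may be differentiated
under the integral sign. -/
lemma hasFDerivAt_integral_of_holomorphic {n : ℕ} {F : (Fin n → ℂ) → (Fin n → ℝ) → ℂ}
    {F' : (Fin n → ℝ) → (Fin n → ℂ) →L[ℂ] ℂ} {c : Fin n → ℂ} {R C : ℝ} (hR : 0 < R)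
    (hF : ∀ z ∈ Metric.ball c R, AEStronglyMeasurable (F z))
    (hF' : AEStronglyMeasurable F')
    (hd : ∀ t, DifferentiableOn ℂ (fun z => F z t) (Metric.ball c R))
    (hFF' : ∀ t, F' t = fderiv ℂ (fun z => F z t) c)
    (hb : ∀ t, ∀ z ∈ Metric.ball c R, ‖F z t‖ ≤ C * ((1 + ‖t‖) ^ (n + 1))⁻¹) :
    HasFDerivAt (fun z => ∫ t, F z t) (∫ t, F' t) c := by
  have hint := (integrable_inv_one_add_norm_pow n).const_mul C
  have hc := Metric.mem_ball_self (x := c) hR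
  refine (hasFDerivAt_integral_of_dominated_loc_of_lip' (Metric.ball_mem_nhds c hR) hF
    (hint.mono' (hF c hc) (.of_forall fun t => hb t c hc)) hF'
    (bound := fun t => 2 * (C * ((1 + ‖t‖) ^ (n + 1))⁻¹) / R)
    (.of_forall fun t z hz => ?_) ((hint.const_mul 2).div_const R) (.of_forall fun t => ?_)).2
  · rw [← dist_eq_norm, ← dist_eq_norm]
    refine Complex.dist_le_div_mul_dist_of_mapsTo_ball (f := fun z => F z t) (hd t)
      (fun w hw => ?_) hz
    rw [Metric.mem_closedBall, dist_eq_norm]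
    linarith [norm_sub_le (F w t) (F c t), hb t w hw, hb t c hc]
  · rw [hFF']
    exact ((hd t).differentiableAt (Metric.ball_mem_nhds c hR)).hasFDerivAt

/-- The integral of a decaying holomorphic function over `ℝⁿ + z` does not depend on the point `z`
of the tube. -/
lemma integral_ofRealVec_add_eq {n : ℕ} {O : Set (Fin n → ℝ)} (hO : IsOpen O) (hOc : Convex ℝ O)
    {H : (Fin n → ℂ) → ℂ} (hd : DifferentiableOn ℂ H {z | imv z ∈ O})
    (hb : ∀ y ∈ O, ∃ r > 0, ∃ M, ∀ z, imv z ∈ Metric.ball y r →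
      (1 + cnorm z) ^ (n + 1) * ‖H z‖ ≤ M)
    {z w : Fin n → ℂ} (hz : imv z ∈ O) (hw : imv w ∈ O) :
    ∫ t, H (ofRealVec t + z) = ∫ t, H (ofRealVec t + w) := by
  have hT : IsOpen {z : Fin n → ℂ | imv z ∈ O} := hO.preimage continuous_imv
  have hTc : Convex ℝ {z : Fin n → ℂ | imv z ∈ O} := by
    intro a ha b hb s t hs ht hst
    have := hOc ha hb hs ht hst
    have heq : imv (s • a + t • b) = s • imv a + t • imv b := by ext i; simp [imv]
    rwa [Set.mem_ofPred_eq, heq]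
  have key : ∀ c : Fin n → ℂ, imv c ∈ O →
      HasFDerivAt (𝕜 := ℂ) (fun z => ∫ t, H (ofRealVec t + z)) 0 c := by
    intro c hc
    obtain ⟨r, hr, M, hM⟩ := hb _ hc
    obtain ⟨r', hr', hrO⟩ := Metric.isOpen_iff.1 hO _ hc
    set R := min r r' with hRdef
    have hR : 0 < R := lt_min hr hr'
    have him : ∀ z ∈ Metric.ball c R, ∀ t, imv (ofRealVec t + z) ∈ Metric.ball (imv c) R := by
      intro z hz t
      rw [imv_ofRealVec_add]
      exact (dist_imv_le z c).trans_lt hz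
    have hmem : ∀ z ∈ Metric.ball c R, ∀ t, imv (ofRealVec t + z) ∈ O := fun z hz t =>
      hrO (Metric.ball_subset_ball (min_le_right _ _) (him z hz t))
    have hda : ∀ z ∈ Metric.ball c R, ∀ t, DifferentiableAt ℂ H (ofRealVec t + z) :=
      fun z hz t => hd.differentiableAt (hT.mem_nhds (hmem z hz t))
    have hder := hasFDerivAt_integral_of_holomorphic (n := n)
      (F := fun z t => H (ofRealVec t + z)) (F' := fun t => fderiv ℂ H (ofRealVec t + c))
      (c := c) (R := R) (C := M * (1 + n * (‖c‖ + R)) ^ (n + 1)) hR ?_ ?_ ?_ ?_ ?_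
    · convert hder using 1
      symm
      set L := ∫ t, fderiv ℂ H (ofRealVec t + c)
      have hreal : ∀ v : Fin n → ℝ, L (ofRealVec v) = 0 := by
        intro v
        have h1 : HasDerivAt (fun s : ℝ => c + s • ofRealVec v) (ofRealVec v) 0 := by
          simpa using ((hasDerivAt_id (0 : ℝ)).smul_const (ofRealVec v)).const_add c
        have h2 : HasDerivAt (fun s : ℝ => ∫ t, H (ofRealVec t + (c + s • ofRealVec v)))
            (L (ofRealVec v)) 0 := by
          have hder' := hder.restrictScalars ℝ
          have : HasFDerivAt (fun z => ∫ t, H (ofRealVec t + z)) (L.restrictScalars ℝ)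
            (c + (0 : ℝ) • ofRealVec v) := by simpa using hder'
          exact this.comp_hasDerivAt (0 : ℝ) h1
        have h3 : (fun s : ℝ => ∫ t, H (ofRealVec t + (c + s • ofRealVec v))) =
            fun _ => ∫ t, H (ofRealVec t + c) := by
          funext s
          rw [← integral_add_right_eq_self (fun t => H (ofRealVec t + c)) (s • v)]
          congr 1; funext t; congr 1
          ext i; simp [ofRealVec]; ring
        rw [h3] at h2
        exact h2.unique (hasDerivAt_const _ _)
      ext u
      have hu : u = ofRealVec (fun i => (u i).re) + I • ofRealVec (fun i => (u i).im) := by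
        ext i
        simp [ofRealVec, mul_comm I, Complex.re_add_im]
      rw [hu, map_add, map_smul, hreal, hreal]
      simp
    · intro z hz
      refine Continuous.aestronglyMeasurable (continuous_iff_continuousAt.2 fun t => ?_)
      exact ContinuousAt.comp (f := fun t => ofRealVec t + z) (hda z hz t).continuousAt
        (continuous_ofRealVec.add continuous_const).continuousAt
    · exact ((measurable_fderiv ℂ H).comp
        (continuous_ofRealVec.add continuous_const).measurable).aestronglyMeasurable
    · intro t z hz
      exact ((hda z hz t).comp z (by fun_prop)).differentiableWithinAt
    · intro t
      exact (fderiv_comp_add_left (f := H) (ofRealVec t)).symm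
    · intro t z hz
      have h1 := hM _ (Metric.ball_subset_ball (min_le_left _ _) (him z hz t))
      have h0 := cnorm_nonneg (ofRealVec t + z)
      have hM0 : 0 ≤ M := le_trans (by positivity) h1
      have h2 : ‖H (ofRealVec t + z)‖ ≤ M * ((1 + cnorm (ofRealVec t + z)) ^ (n + 1))⁻¹ := by
        rw [← div_eq_mul_inv, le_div_iff₀ (by positivity), mul_comm]; exact h1
      have h3 : cnorm z ≤ n * (‖c‖ + R) := by
        refine (cnorm_le_mul_norm z).trans ?_
        gcongr
        have := norm_le_norm_add_norm_sub' z c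
        rw [Metric.mem_ball, dist_eq_norm] at hz
        linarith
      have h4 := cnorm_nonneg z
      calc _ ≤ _ := h2
        _ ≤ M * ((1 + cnorm z) ^ (n + 1) * ((1 + ‖t‖) ^ (n + 1))⁻¹) := by
          gcongr; exact inv_one_add_cnorm_pow_le _ _ _
        _ ≤ M * ((1 + n * (‖c‖ + R)) ^ (n + 1) * ((1 + ‖t‖) ^ (n + 1))⁻¹) := by gcongr
        _ = _ := by ring
  exact hT.is_const_of_fderiv_eq_zero hTc.isPreconnected
    (fun c hc => (key c hc).differentiableAt.differentiableWithinAt)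
    (fun c hc => (key c hc).fderiv) hz hw

lemma norm_le_mul_inv_of_pow_mul_le {n N : ℕ} {f : (Fin n → ℂ) → ℂ} {w : Fin n → ℂ} {M : ℝ}
    (h : (1 + cnorm w) ^ N * ‖f w‖ ≤ M) : ‖f w‖ ≤ M * ((1 + cnorm w) ^ N)⁻¹ := by
  have h0 := cnorm_nonneg w
  rw [← div_eq_mul_inv, le_div_iff₀ (by positivity), mul_comm]
  exact h

lemma memFrak.differentiableOn {n : ℕ} {O : Set (Fin n → ℝ)} {φ : (Fin n → ℂ) → ℂ}
    (hO : IsOpen O) (hφ : memFrak O φ) : DifferentiableOn ℂ φ {z | imv z ∈ O} := by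
  intro z hz
  obtain ⟨r, hr, hrO⟩ := Metric.nhds_basis_closedBall.mem_iff.1 (hO.mem_nhds hz)
  refine ((hφ _ hrO (isCompact_closedBall _ _) (convex_closedBall _ _)).2.1.differentiableAt
    (isOpen_interior.mem_nhds ?_)).differentiableWithinAt
  refine mem_interior.2 ⟨{w | imv w ∈ Metric.ball (imv z) r},
    fun w hw => Metric.ball_subset_closedBall hw, Metric.isOpen_ball.preimage continuous_imv, ?_⟩
  exact Metric.mem_ball_self hr

lemma memFrak.continuous_ofRealVec_add {n : ℕ} {O : Set (Fin n → ℝ)} {φ : (Fin n → ℂ) → ℂ}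
    (hO : IsOpen O) (hφ : memFrak O φ) {z : Fin n → ℂ} (hz : imv z ∈ O) :
    Continuous fun t => φ (ofRealVec t + z) :=
  (hφ.differentiableOn hO).continuousOn.comp_continuous
    (continuous_ofRealVec.add continuous_const)
    fun t => by rwa [Set.mem_ofPred_eq, imv_ofRealVec_add]

lemma memFrakRn.integrable_pow_mul_norm {n : ℕ} {g : (Fin n → ℂ) → ℂ} (hg : memFrakRn g) (j : ℕ) :
    Integrable fun t => (1 + cnorm (ofRealVec t)) ^ j * ‖g (-ofRealVec t)‖ := by
  obtain ⟨M, hM⟩ := hg.2 1 one_pos (j + (n + 1))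
  have hgc := hg.1.continuous
  have hc := continuous_cnorm (n := n)
  have hr := continuous_ofRealVec (n := n)
  refine ((integrable_inv_one_add_norm_pow n).const_mul M).mono'
    (Continuous.aestronglyMeasurable (by fun_prop)) (.of_forall fun t => ?_)
  have h0 := cnorm_nonneg (ofRealVec t)
  have h1 := hM (-ofRealVec t) (fun i => by simp [ofRealVec])
  rw [cnorm_neg] at h1
  have hM0 : 0 ≤ M := le_trans (by positivity) h1
  have h2 := inv_one_add_cnorm_pow_le (n + 1) t 0
  simp only [add_zero, show cnorm (0 : Fin n → ℂ) = 0 by simp [cnorm], one_pow, one_mul] at h2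
  rw [Real.norm_of_nonneg (by positivity)]
  refine le_trans ?_ (mul_le_mul_of_nonneg_left h2 hM0)
  rw [← div_eq_mul_inv, le_div_iff₀ (by positivity)]
  refine le_of_eq_of_le ?_ h1
  ring

/-- Convolution along `ℝⁿ + c` with a function in `𝔥(T(ℝⁿ))` gives a function in `𝔥(T(ℝⁿ))`. -/
lemma memFrakRn.convolution {n : ℕ} {φ g : (Fin n → ℂ) → ℂ} {c : Fin n → ℂ}
    (hφ : Continuous fun t => φ (ofRealVec t + c))
    (hb : ∀ j : ℕ, ∃ M, ∀ t, (1 + cnorm (ofRealVec t + c)) ^ j * ‖φ (ofRealVec t + c)‖ ≤ M)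
    (hg : memFrakRn g) :
    memFrakRn fun z => ∫ t, φ (ofRealVec t + c) * g (z - (ofRealVec t + c)) := by
  have hr := continuous_ofRealVec (n := n)
  have hgc := hg.1.continuous
  have him : ∀ (z : Fin n → ℂ) t i, |(z i - (ofRealVec t i + c i)).im| ≤ |(z i).im| + ‖c‖ := by
    intro z t i
    have h1 : (z i - (ofRealVec t i + c i)).im = (z i).im - (c i).im := by simp [ofRealVec]
    rw [h1]
    exact (abs_sub _ _).trans
      (add_le_add_right ((Complex.abs_im_le_norm _).trans (norm_le_pi_norm c i)) _)
  refine ⟨fun c₀ => ?_, fun m hm j => ?_⟩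
  · obtain ⟨M, hM⟩ := hb (n + 1)
    obtain ⟨M', hM'⟩ := hg.2 (‖c₀‖ + 1 + ‖c‖) (by positivity) 0
    refine (hasFDerivAt_integral_of_holomorphic (c := c₀) (R := 1)
      (F := fun z t => φ (ofRealVec t + c) * g (z - (ofRealVec t + c)))
      (F' := fun t => φ (ofRealVec t + c) • fderiv ℂ g (c₀ - (ofRealVec t + c)))
      (C := M * (1 + cnorm c) ^ (n + 1) * M') one_pos ?_ ?_ ?_ ?_ ?_).differentiableAt
    · intro z _
      exact (hφ.mul (hgc.comp (by fun_prop))).aestronglyMeasurable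
    · refine hφ.aestronglyMeasurable.smul ?_
      exact ((measurable_fderiv ℂ g).comp
        (continuous_const.sub (hr.add continuous_const)).measurable).aestronglyMeasurable
    · intro t
      have hgd := hg.1
      exact Differentiable.differentiableOn (by fun_prop)
    · intro t
      have hgd := hg.1
      rw [← fderiv_comp_sub, ← fderiv_const_mul (by fun_prop)]
    · intro t z hz
      have h1 := norm_le_mul_inv_of_pow_mul_le (hM t)
      have h2 := hM' (z - (ofRealVec t + c)) fun i => (him z t i).trans (by
        rw [Metric.mem_ball, dist_eq_norm] at hz
        have := norm_le_norm_add_norm_sub' z c₀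
        have := (Complex.abs_im_le_norm _).trans (norm_le_pi_norm z i)
        linarith)
      rw [pow_zero, one_mul] at h2
      have hM0 : 0 ≤ M := le_trans
        (mul_nonneg (pow_nonneg (add_nonneg zero_le_one (cnorm_nonneg _)) _) (norm_nonneg _)) (hM t)
      have hM0' : 0 ≤ M' := (norm_nonneg _).trans h2
      have h0 := cnorm_nonneg c
      rw [norm_mul]
      calc _ ≤ (M * ((1 + cnorm c) ^ (n + 1) * ((1 + ‖t‖) ^ (n + 1))⁻¹)) * M' := by
            refine mul_le_mul (h1.trans ?_) h2 (norm_nonneg _) (by positivity)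
            gcongr
            exact inv_one_add_cnorm_pow_le _ _ _
        _ = _ := by ring
  · obtain ⟨M, hM⟩ := hb (j + (n + 1))
    obtain ⟨M', hM'⟩ := hg.2 (m + ‖c‖) (by positivity) j
    refine ⟨∫ t : Fin n → ℝ, M * (1 + cnorm c) ^ (n + 1) * M' * ((1 + ‖t‖) ^ (n + 1))⁻¹, fun z hz => ?_⟩
    have hz0 := cnorm_nonneg z
    rw [← Real.norm_of_nonneg (r := (1 + cnorm z) ^ j) (by positivity), ← norm_real, ← norm_mul,
      ← integral_const_mul]
    refine norm_integral_le_of_norm_le ((integrable_inv_one_add_norm_pow n).const_mul _)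
      (.of_forall fun t => ?_)
    set w := ofRealVec t + c with hw
    have h0 := cnorm_nonneg w
    have h0' := cnorm_nonneg (z - w)
    have h0c := cnorm_nonneg c
    have h1 := hM t
    have h2 := hM' (z - w) fun i => (him z t i).trans (by gcongr; exact hz i)
    have hM0 : 0 ≤ M := le_trans (by positivity) h1
    have hM0' : 0 ≤ M' := le_trans (by positivity) h2
    have h3 : (1 + cnorm z) ^ j ≤ (1 + cnorm w) ^ j * (1 + cnorm (z - w)) ^ j := by
      rw [← mul_pow]
      refine pow_le_pow_left₀ (by positivity) ?_ j
      simpa using one_add_cnorm_add_le w (z - w)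
    have h4 : (1 + cnorm w) ^ j * ‖φ w‖ ≤ M * ((1 + cnorm w) ^ (n + 1))⁻¹ := by
      rw [← div_eq_mul_inv, le_div_iff₀ (by positivity)]
      refine le_of_eq_of_le ?_ h1
      ring
    rw [norm_mul, norm_mul, norm_real, Real.norm_of_nonneg (by positivity)]
    calc _ ≤ ((1 + cnorm w) ^ j * (1 + cnorm (z - w)) ^ j) * (‖φ w‖ * ‖g (z - w)‖) := by gcongr
      _ = ((1 + cnorm w) ^ j * ‖φ w‖) * ((1 + cnorm (z - w)) ^ j * ‖g (z - w)‖) := by ring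
      _ ≤ (M * ((1 + cnorm c) ^ (n + 1) * ((1 + ‖t‖) ^ (n + 1))⁻¹)) * M' := by
          refine mul_le_mul (h4.trans ?_) h2 (by positivity) (by positivity)
          gcongr
          exact inv_one_add_cnorm_pow_le _ _ _
      _ = _ := by ring

/-- The Gaussian `exp (-π ∑ wᵢ²)` on `ℂⁿ`. -/
def gaussC {n : ℕ} (w : Fin n → ℂ) : ℂ := cexp (-∑ i, (Real.pi : ℂ) * w i ^ 2)

lemma norm_gaussC {n : ℕ} (w : Fin n → ℂ) :
    ‖gaussC w‖ = Real.exp (2 * Real.pi * ∑ i, (w i).im ^ 2 - Real.pi * cnorm w ^ 2) := by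
  rw [gaussC, Complex.norm_exp, cnorm, Real.sq_sqrt (by positivity)]
  congr 1
  simp only [neg_re, re_sum, Finset.mul_sum, ← Finset.sum_sub_distrib, ← Finset.sum_neg_distrib]
  refine Finset.sum_congr rfl fun i _ => ?_
  rw [← Complex.normSq_eq_norm_sq, Complex.normSq_apply]
  simp [pow_two]
  ring

lemma memFrakRn_gaussC (n : ℕ) : memFrakRn (gaussC (n := n)) := by
  refine ⟨by unfold gaussC; fun_prop, fun m hm j => ?_⟩
  refine ⟨j.factorial * Real.exp (2 + 2 * Real.pi * ∑ _i : Fin n, m ^ 2), fun z hz => ?_⟩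
  have h0 := cnorm_nonneg z
  have h1 : (1 + cnorm z) ^ j ≤ j.factorial * Real.exp (1 + cnorm z) := by
    have := Real.pow_div_factorial_le_exp (1 + cnorm z) (by positivity) j
    rwa [div_le_iff₀ (by positivity), mul_comm] at this
  have h2 : ∑ i, (z i).im ^ 2 ≤ ∑ _i : Fin n, m ^ 2 :=
    Finset.sum_le_sum fun i _ => sq_le_sq.2 ((hz i).trans (le_abs_self m))
  have hpi := Real.pi_gt_three
  rw [norm_gaussC]
  calc _ ≤ (j.factorial * Real.exp (1 + cnorm z)) *
        Real.exp (2 * Real.pi * ∑ i, (z i).im ^ 2 - Real.pi * cnorm z ^ 2) := by gcongr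
    _ = j.factorial * Real.exp (1 + cnorm z +
        (2 * Real.pi * ∑ i, (z i).im ^ 2 - Real.pi * cnorm z ^ 2)) := by
      rw [mul_assoc, ← Real.exp_add]
    _ ≤ _ := by
      refine mul_le_mul_of_nonneg_left (Real.exp_le_exp.2 ?_) (by positivity)
      nlinarith [mul_le_mul_of_nonneg_left h2 (show 0 ≤ 2 * Real.pi by positivity),
        sq_nonneg (cnorm z - 1), mul_nonneg (sub_nonneg.2 hpi.le) (sq_nonneg (cnorm z))]

lemma integral_gaussC_neg (n : ℕ) : ∫ t : Fin n → ℝ, gaussC (-ofRealVec t) = 1 := by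
  have h := GaussianFourier.integral_cexp_neg_sum_mul_add (ι := Fin n) (b := fun _ => (Real.pi : ℂ))
    (fun _ => by simpa using Real.pi_pos) 0
  simpa [gaussC, ofRealVec, Real.pi_ne_zero] using h

lemma memFrakRn.const_mul_comp_smul {n : ℕ} {g : (Fin n → ℂ) → ℂ} (hg : memFrakRn g) {κ : ℝ}
    (hκ : 1 ≤ κ) (a : ℂ) : memFrakRn fun w => a * g (κ • w) := by
  refine ⟨(hg.1.comp (by fun_prop)).const_mul a, fun m hm j => ?_⟩
  obtain ⟨M, hM⟩ := hg.2 (κ * m) (by positivity) j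
  refine ⟨‖a‖ * M, fun z hz => ?_⟩
  have h0 := cnorm_nonneg z
  have h1 := hM (κ • z) fun i => by
    simp only [Pi.smul_apply, Complex.smul_im, smul_eq_mul, abs_mul,
      abs_of_nonneg (zero_le_one.trans hκ)]
    gcongr
    exact hz i
  have h2 : cnorm z ≤ cnorm (κ • z) := by
    rw [cnorm_real_smul, abs_of_nonneg (zero_le_one.trans hκ)]
    exact le_mul_of_one_le_left h0 hκ
  calc (1 + cnorm z) ^ j * ‖a * g (κ • z)‖ = ‖a‖ * ((1 + cnorm z) ^ j * ‖g (κ • z)‖) := by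
        rw [norm_mul]; ring
    _ ≤ ‖a‖ * ((1 + cnorm (κ • z)) ^ j * ‖g (κ • z)‖) := by gcongr
    _ ≤ _ := by gcongr

/-- Weighted Lipschitz estimate for real translations of a function in `𝔥(T(O))`, uniform over the
tube of a compact convex subset of `O`. -/
lemma memFrak.exists_weighted_norm_sub_le {n : ℕ} {O : Set (Fin n → ℝ)} {φ : (Fin n → ℂ) → ℂ}
    (hO : IsOpen O) (hφ : memFrak O φ) {K : Set (Fin n → ℝ)} (hKO : K ⊆ O) (hKcpt : IsCompact K)
    (hKcvx : Convex ℝ K) (N : ℕ) :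
    ∃ C, 0 ≤ C ∧ ∀ z, imv z ∈ K → ∀ t, (1 + cnorm z) ^ N * ‖φ (ofRealVec t + z) - φ z‖ ≤
      C * (‖t‖ * (1 + cnorm (ofRealVec t)) ^ N) := by
  obtain ⟨δ, hδ, hδO⟩ := hKcpt.exists_cthickening_subset_open hO hKO
  obtain ⟨M, hM⟩ := (hφ _ hδO hKcpt.cthickening (hKcvx.cthickening δ)).2.2 N
  have hmem : ∀ z, imv z ∈ K → ∀ w ∈ Metric.ball z δ, imv w ∈ Metric.cthickening δ K :=
    fun z hz w hw => Metric.mem_cthickening_of_dist_le _ _ _ _ hz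
      ((dist_imv_le w z).trans (Metric.mem_ball.1 hw).le)
  refine ⟨2 * (|M| * (1 + n * δ) ^ N) / δ, by positivity, fun z hz t => ?_⟩
  have hz0 := cnorm_nonneg z
  have ht0 := cnorm_nonneg (ofRealVec t)
  have hw0 := cnorm_nonneg (ofRealVec t + z)
  have hzO := hmem z hz z (Metric.mem_ball_self hδ)
  have hone : 1 ≤ (1 + n * δ) ^ N := one_le_pow₀ (by
    have : 0 ≤ n * δ := by positivity
    linarith)
  have hone' : 1 ≤ (1 + cnorm (ofRealVec t)) ^ N := one_le_pow₀ (by linarith)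
  have hMM := le_abs_self M
  rcases lt_or_ge ‖t‖ δ with ht | ht
  · set B := |M| * (1 + n * δ) ^ N * ((1 + cnorm z) ^ N)⁻¹ with hB
    have hbd : ∀ w ∈ Metric.ball z δ, ‖φ w‖ ≤ B := by
      intro w hw
      have h0 := cnorm_nonneg w
      have h1 : (1 + cnorm z) ^ N ≤ (1 + cnorm w) ^ N * (1 + n * δ) ^ N := by
        rw [← mul_pow]
        refine pow_le_pow_left₀ (by positivity) ?_ N
        have h2 := one_add_cnorm_add_le w (z - w)
        rw [add_sub_cancel] at h2
        refine h2.trans ?_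
        gcongr
        refine (cnorm_le_mul_norm _).trans ?_
        gcongr
        rw [← dist_eq_norm, dist_comm]
        exact (Metric.mem_ball.1 hw).le
      rw [hB, ← div_eq_mul_inv, le_div_iff₀ (by positivity)]
      calc ‖φ w‖ * (1 + cnorm z) ^ N ≤ ‖φ w‖ * ((1 + cnorm w) ^ N * (1 + n * δ) ^ N) := by gcongr
        _ = ((1 + cnorm w) ^ N * ‖φ w‖) * (1 + n * δ) ^ N := by ring
        _ ≤ |M| * (1 + n * δ) ^ N := by
          gcongr
          exact (hM w (hmem z hz w hw)).trans hMM
    have hdist : dist (ofRealVec t + z) z = ‖t‖ := by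
      rw [dist_eq_norm, add_sub_cancel_right, norm_ofRealVec]
    have hL := Complex.dist_le_div_mul_dist_of_mapsTo_ball (f := φ) (c := z) (R₁ := δ) (R₂ := 2 * B)
      (z := ofRealVec t + z)
      ((hφ.differentiableOn hO).mono fun w hw => hδO (hmem z hz w hw))
      (fun w hw => by
        rw [Metric.mem_closedBall, dist_eq_norm]
        linarith [norm_sub_le (φ w) (φ z), hbd w hw, hbd z (Metric.mem_ball_self hδ)])
      (by rwa [Metric.mem_ball, hdist])
    rw [dist_eq_norm, hdist] at hL
    calc _ ≤ (1 + cnorm z) ^ N * (2 * B / δ * ‖t‖) := by gcongr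
      _ = 2 * (|M| * (1 + n * δ) ^ N) / δ * (‖t‖ * 1) := by
        rw [hB]; field_simp
      _ ≤ _ := by gcongr
  · have h1 : (1 + cnorm z) ^ N ≤
        (1 + cnorm (ofRealVec t + z)) ^ N * (1 + cnorm (ofRealVec t)) ^ N := by
      rw [← mul_pow]
      refine pow_le_pow_left₀ (by positivity) ?_ N
      simpa [cnorm_neg] using one_add_cnorm_add_le (ofRealVec t + z) (-ofRealVec t)
    have h2 := hM z hzO
    have h3 := hM (ofRealVec t + z) (by rwa [imv_ofRealVec_add])
    calc _ ≤ (1 + cnorm z) ^ N * (‖φ (ofRealVec t + z)‖ + ‖φ z‖) := by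
          gcongr; exact norm_sub_le _ _
      _ = (1 + cnorm z) ^ N * ‖φ (ofRealVec t + z)‖ + (1 + cnorm z) ^ N * ‖φ z‖ := mul_add _ _ _
      _ ≤ (1 + cnorm (ofRealVec t + z)) ^ N * (1 + cnorm (ofRealVec t)) ^ N *
            ‖φ (ofRealVec t + z)‖ + |M| * (1 + cnorm (ofRealVec t)) ^ N := by
          refine add_le_add (by gcongr) ?_
          exact (h2.trans hMM).trans (le_mul_of_one_le_right (abs_nonneg M) hone')
      _ = ((1 + cnorm (ofRealVec t + z)) ^ N * ‖φ (ofRealVec t + z)‖) *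
            (1 + cnorm (ofRealVec t)) ^ N + |M| * (1 + cnorm (ofRealVec t)) ^ N := by ring
      _ ≤ |M| * (1 + cnorm (ofRealVec t)) ^ N + |M| * (1 + cnorm (ofRealVec t)) ^ N := by
          gcongr; exact h3.trans hMM
      _ = 2 * (|M| * 1) / δ * (δ * (1 + cnorm (ofRealVec t)) ^ N) := by field_simp; ring
      _ ≤ _ := by gcongr

/-- Gaussian mollification along `ℝⁿ + c` is, at every point `z` of the tube, an average of real
translates of `φ` around `z`. -/
lemma memFrak.integral_gaussC_eq {n : ℕ} {O : Set (Fin n → ℝ)} {φ : (Fin n → ℂ) → ℂ}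
    (hO : IsOpen O) (hOc : Convex ℝ O) (hφ : memFrak O φ) {κ : ℝ} (hκ : 1 ≤ κ)
    {c z : Fin n → ℂ} (hc : imv c ∈ O) (hz : imv z ∈ O) :
    ∫ t, φ (ofRealVec t + c) * (((κ ^ n : ℝ) : ℂ) * gaussC (κ • (z - (ofRealVec t + c)))) =
      ∫ u, φ (ofRealVec (κ⁻¹ • u) + z) * gaussC (-ofRealVec u) := by
  have hκ0 : 0 < κ := by linarith
  have hg := (memFrakRn_gaussC n).const_mul_comp_smul hκ ((κ ^ n : ℝ) : ℂ)
  have hgd := hg.1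
  rw [integral_ofRealVec_add_eq (w := z) hO hOc
    (H := fun w => φ w * (((κ ^ n : ℝ) : ℂ) * gaussC (κ • (z - w)))) ?_ ?_ hc hz]
  · have h := Measure.integral_comp_smul (volume : Measure (Fin n → ℝ))
      (fun t => φ (ofRealVec t + z) *
        (((κ ^ n : ℝ) : ℂ) * gaussC (κ • (z - (ofRealVec t + z))))) κ⁻¹
    have h2 : (|((κ⁻¹) ^ Module.finrank ℝ (Fin n → ℝ))⁻¹| : ℝ) = κ ^ n := by
      rw [Module.finrank_fin_fun, inv_pow, inv_inv, abs_of_pos (by positivity)]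
    have h3 : ∀ u : Fin n → ℝ, κ • (z - (ofRealVec (κ⁻¹ • u) + z)) = -ofRealVec u := by
      intro u
      ext i
      simp [ofRealVec, hκ0.ne']
    have h4 : ((κ ^ n : ℝ) : ℂ) ≠ 0 := by exact_mod_cast (pow_pos hκ0 n).ne'
    rw [h2, Complex.real_smul] at h
    refine mul_left_cancel₀ h4 (h.symm.trans ?_)
    rw [← integral_const_mul]
    congr 1
    funext u
    rw [h3]
    ring
  · exact (hφ.differentiableOn hO).mul
      (hgd.comp (f := fun w => z - w) (by fun_prop)).differentiableOn
  · intro y hy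
    obtain ⟨r, hr, hrO⟩ := Metric.nhds_basis_closedBall.mem_iff.1 (hO.mem_nhds hy)
    obtain ⟨M, hM⟩ := (hφ _ hrO (isCompact_closedBall _ _) (convex_closedBall _ _)).2.2 (n + 1)
    obtain ⟨M', hM'⟩ := hg.2 (‖imv z‖ + ‖y‖ + r) (by positivity) 0
    refine ⟨r, hr, M * M', fun w hw => ?_⟩
    have h1 := hM w (Metric.ball_subset_closedBall hw)
    have h2 := hM' (z - w) fun i => by
      have a1 := norm_le_pi_norm (imv z) i
      have a2 := norm_le_pi_norm (imv w) i
      have a3 := norm_le_norm_add_norm_sub' (imv w) y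
      have a4 : ‖imv w - y‖ < r := by rwa [Metric.mem_ball, dist_eq_norm] at hw
      calc |((z - w) i).im| = |(z i).im - (w i).im| := by simp
        _ ≤ |(z i).im| + |(w i).im| := abs_sub _ _
        _ ≤ ‖imv z‖ + ‖imv w‖ := add_le_add a1 a2
        _ ≤ _ := by linarith
    rw [pow_zero, one_mul] at h2
    have h0 := cnorm_nonneg w
    rw [norm_mul, ← mul_assoc]
    exact mul_le_mul h1 h2 (norm_nonneg _) (le_trans (by positivity) h1)

/-- `𝔥(T(ℝⁿ))` is dense in `𝔥(T(O))`. -/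
theorem stmt_7 {n : ℕ} (O : Set (Fin n → ℝ)) (hO : IsOpen O) (hOc : Convex ℝ O)
    (φ : (Fin n → ℂ) → ℂ) (hφ : memFrak O φ)
    (K : Set (Fin n → ℝ)) (hKO : K ⊆ O) (hKcpt : IsCompact K) (hKcvx : Convex ℝ K)
    (N : ℕ) (ε : ℝ) (hε : 0 < ε) :
    ∃ χ : (Fin n → ℂ) → ℂ, memFrakRn χ ∧
      ∀ z : Fin n → ℂ, imv z ∈ K → (1 + cnorm z) ^ N * ‖φ z - χ z‖ < ε := by
  rcases K.eq_empty_or_nonempty with rfl | ⟨y, hy⟩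
  · exact ⟨0, ⟨differentiable_const 0, fun m _ j => ⟨0, fun z _ => by simp⟩⟩, fun z hz => hz.elim⟩
  set c : Fin n → ℂ := fun i => (y i : ℂ) * I with hcdef
  have hc : imv c = y := by ext i; simp [hcdef, imv]
  obtain ⟨C, hC, hL⟩ := hφ.exists_weighted_norm_sub_le hO hKO hKcpt hKcvx N
  set A := ∫ u : Fin n → ℝ, (1 + cnorm (ofRealVec u)) ^ (N + 1) * ‖gaussC (-ofRealVec u)‖
    with hA
  have hA0 : 0 ≤ A := integral_nonneg fun u =>
    mul_nonneg (pow_nonneg (add_nonneg zero_le_one (cnorm_nonneg _)) _) (norm_nonneg _)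
  obtain ⟨κ, hκdef⟩ : ∃ κ, κ = C * A / ε + 1 := ⟨_, rfl⟩
  have hκ : 1 ≤ κ := by rw [hκdef, le_add_iff_nonneg_left]; positivity
  have hκ0 : 0 < κ := by linarith
  refine ⟨_, memFrakRn.convolution (hφ.continuous_ofRealVec_add hO (z := c) (hc ▸ hKO hy))
    (fun j => ?_) ((memFrakRn_gaussC n).const_mul_comp_smul hκ ((κ ^ n : ℝ) : ℂ)), fun z hz => ?_⟩
  · obtain ⟨M, hM⟩ := (hφ K hKO hKcpt hKcvx).2.2 j
    exact ⟨M, fun t => hM _ (by rwa [imv_ofRealVec_add, hc])⟩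
  have hz0 := cnorm_nonneg z
  have hG := memFrakRn_gaussC n
  have hGc := hG.1.continuous
  have hGr : Continuous fun u : Fin n → ℝ => gaussC (-ofRealVec u) :=
    hGc.comp continuous_ofRealVec.neg
  have hGi : Integrable fun u : Fin n → ℝ => gaussC (-ofRealVec u) := by
    rw [← integrable_norm_iff hGr.aestronglyMeasurable]
    simpa using hG.integrable_pow_mul_norm 0
  have hφc : Continuous fun u : Fin n → ℝ => φ (ofRealVec (κ⁻¹ • u) + z) :=
    (hφ.continuous_ofRealVec_add hO (hKO hz)).comp (continuous_const_smul κ⁻¹)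
  have hφi : Integrable fun u => φ (ofRealVec (κ⁻¹ • u) + z) * gaussC (-ofRealVec u) := by
    obtain ⟨M, hM⟩ := (hφ K hKO hKcpt hKcvx).2.2 0
    refine hGi.bdd_mul hφc.aestronglyMeasurable (c := M) (.of_forall fun u => ?_)
    simpa using hM (ofRealVec (κ⁻¹ • u) + z) (by rwa [imv_ofRealVec_add])
  rw [hφ.integral_gaussC_eq hO hOc hκ (hc ▸ hKO hy) (hKO hz), norm_sub_rev]
  have hφz : φ z = ∫ u : Fin n → ℝ, φ z * gaussC (-ofRealVec u) := by
    rw [integral_const_mul, integral_gaussC_neg, mul_one]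
  rw [hφz, ← integral_sub hφi (hGi.const_mul _),
    ← Real.norm_of_nonneg (r := (1 + cnorm z) ^ N) (by positivity), ← norm_real, ← norm_mul,
    ← integral_const_mul]
  refine lt_of_le_of_lt (norm_integral_le_of_norm_le
    ((hG.integrable_pow_mul_norm (N + 1)).const_mul (C * κ⁻¹)) (.of_forall fun u => ?_)) ?_
  · have hu0 := cnorm_nonneg (ofRealVec u)
    have h1 : cnorm (ofRealVec (κ⁻¹ • u)) ≤ cnorm (ofRealVec u) := by
      have : ofRealVec (κ⁻¹ • u) = κ⁻¹ • ofRealVec u := by ext i; simp [ofRealVec]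
      rw [this, cnorm_real_smul, abs_of_pos (by positivity)]
      exact mul_le_of_le_one_left hu0 (inv_le_one_of_one_le₀ hκ)
    have h2 : ‖u‖ ≤ 1 + cnorm (ofRealVec u) := by
      rw [← norm_ofRealVec]
      linarith [norm_le_cnorm (ofRealVec u)]
    have h3 := cnorm_nonneg (ofRealVec (κ⁻¹ • u))
    have h4 : (1 + cnorm z) ^ N * ‖φ (ofRealVec (κ⁻¹ • u) + z) - φ z‖ ≤
        C * κ⁻¹ * (1 + cnorm (ofRealVec u)) ^ (N + 1) := by
      refine (hL z hz (κ⁻¹ • u)).trans ?_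
      rw [norm_smul, Real.norm_of_nonneg (by positivity : 0 ≤ κ⁻¹)]
      calc _ ≤ C * (κ⁻¹ * (1 + cnorm (ofRealVec u)) * (1 + cnorm (ofRealVec u)) ^ N) := by gcongr
        _ = _ := by ring
    rw [← sub_mul, norm_mul, norm_mul, norm_real, Real.norm_of_nonneg (by positivity), ← mul_assoc,
      ← mul_assoc]
    exact mul_le_mul_of_nonneg_right h4 (norm_nonneg _)
  · rw [integral_const_mul, ← hA, mul_right_comm, ← div_eq_mul_inv, div_lt_iff₀ hκ0, hκdef, mul_add,
      mul_div_cancel₀ _ hε.ne']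
    linarith
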